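/- Let H = (V, E) be a finite hypergraph with n vertices and m edges, b_v ∈ ℕ with b_v ≤ d(v) for every vertex v, and k_v := d(v) − b_v. Let Δ̄ be the average vertex degree, ℓ̄ the average edge size, ℓ the maximum edge size, b̄ the average of (b_v), Opt the minimum cardinality of a set multicover, and ν_k(H) the maximum cardinality of a k-matching. If M is a k-matching with |M| ≥ r · ν_k(H) for some real 0 < r ≤ 1, then S := E \ M is a set multicover with |S| ≤ ( (Δ̄ℓ)/(b̄ℓ̄) · (1 − r) + r ) · Opt. -/

import Mathlib

open Finset

/-- `M` is a `k`-matching: every vertex `v` lies in at most `k v` edges of `M`. -/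
def IsKMatching {V ι : Type*} [DecidableEq V] (E : ι → Finset V) (k : V → ℕ)
    (M : Finset ι) : Prop :=
  ∀ v : V, (M.filter (fun i => v ∈ E i)).card ≤ k v

/-- `C` is a `b`-set multicover: every vertex `v` lies in at least `b v` edges of `C`. -/
def IsMulticover {V ι : Type*} [DecidableEq V] (E : ι → Finset V) (b : V → ℕ)
    (C : Finset ι) : Prop :=
  ∀ v : V, b v ≤ (C.filter (fun i => v ∈ E i)).card

/-- The edges of `C` and of `Cᶜ` through a vertex together are all the edges through it. -/
lemma card_filter_add_card_filter_compl {V ι : Type*} [Fintype ι] [DecidableEq V]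
    [DecidableEq ι] (E : ι → Finset V) (C : Finset ι) (v : V) :
    (C.filter (fun i => v ∈ E i)).card + (Cᶜ.filter (fun i => v ∈ E i)).card =
      (univ.filter (fun i => v ∈ E i)).card := by
  rw [← card_union_of_disjoint (disjoint_filter_filter disjoint_compl_right), ← filter_union,
    union_compl]

lemma IsKMatching.isMulticover_compl {V ι : Type*} [Fintype ι] [DecidableEq V]
    [DecidableEq ι] {E : ι → Finset V} {b : V → ℕ}
    (hbd : ∀ v : V, b v ≤ (univ.filter (fun i => v ∈ E i)).card) {M : Finset ι}
    (hM : IsKMatching E (fun v => (univ.filter (fun i => v ∈ E i)).card - b v) M) :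
    IsMulticover E b Mᶜ := by
  intro v
  have h := card_filter_add_card_filter_compl E M v
  have hv := hM v
  have hb := hbd v
  dsimp only at hv
  omega

lemma IsMulticover.isKMatching_compl {V ι : Type*} [Fintype ι] [DecidableEq V]
    [DecidableEq ι] {E : ι → Finset V} {b : V → ℕ} {C : Finset ι} (hC : IsMulticover E b C) :
    IsKMatching E (fun v => (univ.filter (fun i => v ∈ E i)).card - b v) Cᶜ := by
  intro v
  have h := card_filter_add_card_filter_compl E C v
  have hv := hC v
  dsimp only
  omega

lemma sum_card_filter_mem {V ι : Type*} [Fintype V] [DecidableEq V] (E : ι → Finset V)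
    (C : Finset ι) :
    ∑ v : V, (C.filter (fun i => v ∈ E i)).card = ∑ i ∈ C, (E i).card := by
  simpa [bipartiteAbove, bipartiteBelow] using
    sum_card_bipartiteAbove_eq_sum_card_bipartiteBelow (s := univ) (t := C)
      (fun (v : V) i => v ∈ E i)

/-- The total demand is at most the maximum edge size times the size of a multicover. -/
lemma IsMulticover.sum_le_mul_card {V ι : Type*} [Fintype V] [DecidableEq V]
    {E : ι → Finset V} {b : V → ℕ} {C : Finset ι} (hC : IsMulticover E b C) {ℓ : ℕ}
    (hℓ : ∀ i, (E i).card ≤ ℓ) : ∑ v, b v ≤ ℓ * C.card :=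
  calc ∑ v, b v ≤ ∑ v : V, (C.filter (fun i => v ∈ E i)).card := sum_le_sum fun v _ => hC v
    _ = ∑ i ∈ C, (E i).card := sum_card_filter_mem E C
    _ ≤ ∑ _i ∈ C, ℓ := sum_le_sum fun i _ => hℓ i
    _ = ℓ * C.card := by rw [sum_const, smul_eq_mul, mul_comm]

/-- Theorem 7: if `M` is a `k`-matching (`k_v = d(v) - b_v`) with
`|M| ≥ r·ν_k(H)`, then `S = E \ M` is a set multicover with
`|S| ≤ ((Δ̄ℓ/(b̄ℓ̄))·(1-r) + r)·Opt`. -/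
theorem multicover_from_approx_matching
    {V ι : Type*} [Fintype V] [Fintype ι] [DecidableEq V] [DecidableEq ι]
    [Nonempty V] [Nonempty ι]
    (E : ι → Finset V) (b : V → ℕ) (hb1 : ∀ v, 1 ≤ b v)
    (hbd : ∀ v : V, b v ≤ (univ.filter (fun i => v ∈ E i)).card)
    (ℓ : ℕ) (hℓ : ∀ i, (E i).card ≤ ℓ)
    (r : ℝ) (hr0 : 0 < r) (hr1 : r ≤ 1)
    (M : Finset ι)
    (hM : IsKMatching E (fun v => (univ.filter (fun i => v ∈ E i)).card - b v) M)
    (hMr : r * (sSup {c : ℕ | ∃ M' : Finset ι,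
        IsKMatching E (fun v => (univ.filter (fun i => v ∈ E i)).card - b v) M' ∧
        M'.card = c} : ℕ) ≤ (M.card : ℝ)) :
    IsMulticover E b Mᶜ ∧
    ((Mᶜ.card : ℝ) ≤
      ((((∑ v : V, ((univ.filter (fun i => v ∈ E i)).card : ℝ)) / Fintype.card V) * ℓ /
        (((∑ v : V, (b v : ℝ)) / Fintype.card V) *
          ((∑ i : ι, ((E i).card : ℝ)) / Fintype.card ι))) * (1 - r) + r) *
        (sInf {c : ℕ | ∃ C : Finset ι, IsMulticover E b C ∧ C.card = c} : ℕ)) := by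
  have hcov := hM.isMulticover_compl hbd
  refine ⟨hcov, ?_⟩
  set ν := sSup {c : ℕ | ∃ M' : Finset ι,
    IsKMatching E (fun v => (univ.filter (fun i => v ∈ E i)).card - b v) M' ∧ M'.card = c}
    with hν
  obtain ⟨C, hC, hCcard⟩ :=
    Nat.sInf_mem (s := {c : ℕ | ∃ C : Finset ι, IsMulticover E b C ∧ C.card = c})
      ⟨_, Mᶜ, hcov, rfl⟩
  rw [← hCcard]
  have hCν : Cᶜ.card ≤ ν := by
    refine le_csSup ⟨Fintype.card ι, ?_⟩ ⟨Cᶜ, hC.isKMatching_compl, rfl⟩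
    rintro _ ⟨M', -, rfl⟩
    exact card_le_univ M'
  have hCm : (Fintype.card ι : ℝ) ≤ ν + C.card := by
    have := card_add_card_compl C
    exact_mod_cast (by omega : Fintype.card ι ≤ ν + C.card)
  have hMm : (M.card : ℝ) + Mᶜ.card = Fintype.card ι := by
    exact_mod_cast card_add_card_compl M
  have hB : ∑ v : V, (b v : ℝ) ≤ ℓ * C.card := by
    exact_mod_cast hC.sum_le_mul_card hℓ
  have hB0 : 0 < ∑ v : V, (b v : ℝ) :=
    sum_pos (fun v _ => by exact_mod_cast hb1 v) univ_nonempty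
  have hBD : ∑ v : V, (b v : ℝ) ≤ ∑ v : V, ((univ.filter (fun i => v ∈ E i)).card : ℝ) :=
    sum_le_sum fun v _ => by exact_mod_cast hbd v
  have hD : ∑ i : ι, ((E i).card : ℝ) = ∑ v : V, ((univ.filter (fun i => v ∈ E i)).card : ℝ) := by
    exact_mod_cast (sum_card_filter_mem E univ).symm
  rw [hD]
  have hn : (0 : ℝ) < Fintype.card V := by exact_mod_cast Fintype.card_pos
  have hm : (0 : ℝ) < Fintype.card ι := by exact_mod_cast Fintype.card_pos
  set D := ∑ v : V, ((univ.filter (fun i => v ∈ E i)).card : ℝ)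
  set B := ∑ v : V, (b v : ℝ)
  have hD0 : 0 < D := hB0.trans_le hBD
  have hcoeff : D / Fintype.card V * ℓ / (B / Fintype.card V * (D / Fintype.card ι)) =
      ℓ * Fintype.card ι / B := by
    field_simp
  rw [hcoeff]
  have hmle : (Fintype.card ι : ℝ) ≤ ℓ * Fintype.card ι / B * C.card := by
    rw [div_mul_eq_mul_div, le_div_iff₀ hB0]
    nlinarith
  have hr : r * (Fintype.card ι : ℝ) ≤ r * (ν + C.card) := mul_le_mul_of_nonneg_left hCm hr0.le
  have hr' := mul_le_mul_of_nonneg_left hmle (sub_nonneg.2 hr1)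
  linarith
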